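/- Let j, i_1, …, i_r ∈ {1,…,n}, put γ = s_{i_r}⋯s_{i_1}(α_j) and t = s_{i_r}⋯s_{i_1}·s_j·s_{i_1}⋯s_{i_r} ∈ W. Then the following are equivalent: (a) for every 1 ≤ k ≤ r one has s_{i_k}s_{i_{k−1}}⋯s_{i_1}(α_j) − s_{i_{k−1}}⋯s_{i_1}(α_j) ∈ ℝ_{>0}·α_{i_k} (that is, s_{i_r}⋯s_{i_1}(α_j) is a positive expression); (b) ℓ(t) = 2r + 1. Moreover, when these conditions hold, γ is a positive root and t = t_γ. -/

import Mathlib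

/-!
Setup: a symmetrizable crystallographic Cartan matrix `A` with symmetrizers `d`,
the vector space `V = Fin n → ℝ` with standard basis `α i = Pi.single i 1`,
the bilinear form `(α i, α j) = d i * A i j`, the simple reflections
`s i (x) = x - (dᵢ⁻¹ αᵢ, x) αᵢ`, the group `W` generated by them (elements of
which are represented as products of lists of simple reflections), and the
set of real roots `Φ = { w (α i) }`.
-/

open Finset

noncomputable section

/-- The simple root `α i`, i.e. the `i`-th standard basis vector of `ℝⁿ`. -/
def sroot (n : ℕ) (i : Fin n) : Fin n → ℝ := Pi.single i 1

/-- The symmetric bilinear form with `(α i, α j) = d i * A i j`. -/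
def formL (n : ℕ) (d : Fin n → ℤ) (A : Fin n → Fin n → ℤ) :
    (Fin n → ℝ) →ₗ[ℝ] (Fin n → ℝ) →ₗ[ℝ] ℝ :=
  ∑ i : Fin n, ∑ j : Fin n,
    ((d i * A i j : ℤ) : ℝ) •
      LinearMap.smulRight (LinearMap.proj i : (Fin n → ℝ) →ₗ[ℝ] ℝ)
        (LinearMap.proj j : (Fin n → ℝ) →ₗ[ℝ] ℝ)

/-- The simple reflection `s i`, given by `s i x = x - (dᵢ⁻¹ • αᵢ, x) • αᵢ`. -/
def simpleRefl (n : ℕ) (d : Fin n → ℤ) (A : Fin n → Fin n → ℤ) (i : Fin n) :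
    Module.End ℝ (Fin n → ℝ) :=
  LinearMap.id - ((d i : ℝ)⁻¹) • (formL n d A (sroot n i)).smulRight (sroot n i)

/-- The element `s i_r * ⋯ * s i_1` of `W` corresponding to the list `l = [i_1, …, i_r]`
(the reflection `s i_1` is applied first). -/
def wprod (n : ℕ) (d : Fin n → ℤ) (A : Fin n → Fin n → ℤ) (l : List (Fin n)) :
    Module.End ℝ (Fin n → ℝ) :=
  ((l.map (simpleRefl n d A)).reverse).prod

/-- `β` is a real root: `β = w (α i)` for some `w ∈ W` and some `i`. -/
def IsRoot (n : ℕ) (d : Fin n → ℤ) (A : Fin n → Fin n → ℤ) (β : Fin n → ℝ) : Prop :=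
  ∃ (l : List (Fin n)) (i : Fin n), β = wprod n d A l (sroot n i)

/-- `β` is a positive root: a real root all of whose coordinates are `≥ 0`. -/
def IsPosRoot (n : ℕ) (d : Fin n → ℤ) (A : Fin n → Fin n → ℤ) (β : Fin n → ℝ) : Prop :=
  IsRoot n d A β ∧ ∀ k, 0 ≤ β k

/-- `β` is a negative root: a real root all of whose coordinates are `≤ 0`. -/
def IsNegRoot (n : ℕ) (d : Fin n → ℤ) (A : Fin n → Fin n → ℤ) (β : Fin n → ℝ) : Prop :=
  IsRoot n d A β ∧ ∀ k, β k ≤ 0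

/-- The reflection `t_β` along a root `β`: `t_β x = x - (β^∨, x) • β` where
`β^∨ = d_β⁻¹ • β` and `d_β = (β, β)/2`. -/
def reflAlong (n : ℕ) (d : Fin n → ℤ) (A : Fin n → Fin n → ℤ) (β : Fin n → ℝ) :
    Module.End ℝ (Fin n → ℝ) :=
  LinearMap.id - (2 / formL n d A β β) • (formL n d A β).smulRight β

/-- `s i_r ⋯ s i_1 (α j)` (encoded by the list `l = [i_1, …, i_r]` and the index `j`)
is a positive expression: each partial application moves up in the root poset, i.e.
`s i_k ⋯ s i_1 (α j) - s i_{k-1} ⋯ s i_1 (α j) ∈ ℝ_{>0} • α i_k` for all `k`. -/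
def IsPosExpr (n : ℕ) (d : Fin n → ℤ) (A : Fin n → Fin n → ℤ) (j : Fin n)
    (l : List (Fin n)) : Prop :=
  ∀ k : Fin l.length, ∃ c : ℝ, 0 < c ∧
    wprod n d A (l.take (k.1 + 1)) (sroot n j) - wprod n d A (l.take k.1) (sroot n j)
      = c • sroot n (l.get k)

/-- The length `ℓ(w)`: the smallest `r` such that `w` is a product of `r` simple
reflections. -/
def len (n : ℕ) (d : Fin n → ℤ) (A : Fin n → Fin n → ℤ)
    (w : Module.End ℝ (Fin n → ℝ)) : ℕ :=
  sInf {r | ∃ l : List (Fin n), l.length = r ∧ wprod n d A l = w}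

/-- The hypotheses on the Cartan datum, bundled. -/
structure CD (n : ℕ) (d : Fin n → ℤ) (A : Fin n → Fin n → ℤ) : Prop where
  hd : ∀ i, 0 < d i
  hdiag : ∀ i, A i i = 2
  hoff : ∀ i j, i ≠ j → A i j ≤ 0
  hsym : ∀ i j, d i * A i j = d j * A j i

section aux

variable {n : ℕ} {d : Fin n → ℤ} {A : Fin n → Fin n → ℤ}

lemma formL_apply (x y : Fin n → ℝ) :
    formL n d A x y = ∑ i, ∑ j, ((d i : ℝ) * A i j) * (x i * y j) := by
  simp [formL, LinearMap.sum_apply]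

lemma formL_sroot_left (i : Fin n) (y : Fin n → ℝ) :
    formL n d A (sroot n i) y = ∑ j, ((d i : ℝ) * A i j) * y j := by
  rw [formL_apply, Finset.sum_eq_single i]
  · simp [sroot]
  · intro b _ hb
    simp [sroot, hb]
  · simp

lemma formL_sroot (i j : Fin n) :
    formL n d A (sroot n i) (sroot n j) = (d i : ℝ) * A i j := by
  rw [formL_sroot_left, Finset.sum_eq_single j]
  · simp [sroot]
  · intro b _ hb
    simp [sroot, hb]
  · simp

lemma formL_symm (h : CD n d A) (x y : Fin n → ℝ) :
    formL n d A x y = formL n d A y x := by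
  rw [formL_apply, formL_apply, Finset.sum_comm]
  refine Finset.sum_congr rfl fun i _ => Finset.sum_congr rfl fun j _ => ?_
  have := h.hsym i j
  have h2 : (d i : ℝ) * A i j = d j * A j i := by exact_mod_cast this
  rw [h2]; ring

lemma CD.dpos (h : CD n d A) (i : Fin n) : (0 : ℝ) < d i := by exact_mod_cast h.hd i

lemma formL_self (h : CD n d A) (i : Fin n) :
    formL n d A (sroot n i) (sroot n i) = 2 * d i := by
  rw [formL_sroot, h.hdiag]; push_cast; ring

lemma srefl_apply (i : Fin n) (x : Fin n → ℝ) :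
    simpleRefl n d A i x = x - ((d i : ℝ)⁻¹ * formL n d A (sroot n i) x) • sroot n i := by
  simp [simpleRefl, smul_smul]

lemma srefl_self (h : CD n d A) (i : Fin n) :
    simpleRefl n d A i (sroot n i) = - sroot n i := by
  have := h.dpos i
  rw [srefl_apply, formL_self h]
  have e : (d i : ℝ)⁻¹ * (2 * d i) = 2 := by field_simp
  rw [e, two_smul]; abel

lemma srefl_invol (h : CD n d A) (i : Fin n) :
    simpleRefl n d A i * simpleRefl n d A i = 1 := by
  refine LinearMap.ext fun x => ?_
  rw [Module.End.mul_apply, srefl_apply i x, map_sub, map_smul, srefl_self h, srefl_apply i x]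
  simp

lemma srefl_form (h : CD n d A) (i : Fin n) (x y : Fin n → ℝ) :
    formL n d A (simpleRefl n d A i x) (simpleRefl n d A i y) = formL n d A x y := by
  have := h.dpos i
  simp only [srefl_apply, map_sub, map_smul, LinearMap.sub_apply, LinearMap.smul_apply,
    smul_eq_mul, formL_self h, formL_symm h x (sroot n i)]
  field_simp
  ring

lemma wprod_nil : wprod n d A [] = 1 := by simp [wprod]

lemma wprod_append (p q : List (Fin n)) :
    wprod n d A (p ++ q) = wprod n d A q * wprod n d A p := by simp [wprod]

lemma wprod_single (i : Fin n) : wprod n d A [i] = simpleRefl n d A i := by simp [wprod]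

lemma wprod_cons (i : Fin n) (q : List (Fin n)) :
    wprod n d A (i :: q) = wprod n d A q * simpleRefl n d A i := by simp [wprod]

lemma wprod_snoc (i : Fin n) (q : List (Fin n)) :
    wprod n d A (q ++ [i]) = simpleRefl n d A i * wprod n d A q := by simp [wprod]

lemma wprod_rev_mul (h : CD n d A) (l : List (Fin n)) :
    wprod n d A l.reverse * wprod n d A l = 1 := by
  induction l with
  | nil => simp [wprod_nil]
  | cons i l ih =>
    rw [List.reverse_cons, wprod_snoc, wprod_cons, mul_assoc, ← mul_assoc (wprod n d A l.reverse),
      ih, one_mul, srefl_invol h]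

lemma wprod_mul_rev (h : CD n d A) (l : List (Fin n)) :
    wprod n d A l * wprod n d A l.reverse = 1 := by
  simpa using wprod_rev_mul h l.reverse

lemma wprod_form (h : CD n d A) (l : List (Fin n)) (x y : Fin n → ℝ) :
    formL n d A (wprod n d A l x) (wprod n d A l y) = formL n d A x y := by
  induction l generalizing x y with
  | nil => simp [wprod_nil]
  | cons i l ih => rw [wprod_cons, Module.End.mul_apply, Module.End.mul_apply, ih, srefl_form h]

lemma wprod_inj (h : CD n d A) (l : List (Fin n)) {x : Fin n → ℝ} (hx : wprod n d A l x = 0) :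
    x = 0 := by
  have := congrArg (fun f => f x) (wprod_rev_mul h l)
  simpa [hx] using this.symm

/-- integer vectors -/
def IntVec (n : ℕ) (v : Fin n → ℝ) : Prop := ∀ k, ∃ z : ℤ, v k = z

lemma IntVec_sroot (i : Fin n) : IntVec n (sroot n i) := by
  intro k
  by_cases hk : k = i
  · exact ⟨1, by simp [sroot, hk]⟩
  · exact ⟨0, by simp [sroot, hk]⟩

lemma srefl_coef (h : CD n d A) (i : Fin n) (x : Fin n → ℝ) :
    (d i : ℝ)⁻¹ * formL n d A (sroot n i) x = ∑ j, (A i j : ℝ) * x j := by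
  have := h.dpos i
  rw [formL_sroot_left, Finset.mul_sum]
  refine Finset.sum_congr rfl fun j _ => ?_
  field_simp

lemma IntVec_srefl (h : CD n d A) (i : Fin n) {x : Fin n → ℝ} (hx : IntVec n x) :
    IntVec n (simpleRefl n d A i x) := by
  choose z hz using hx
  obtain ⟨w, hw⟩ := IntVec_sroot i |> Classical.axiomOfChoice
  intro k
  refine ⟨z k - (∑ j, A i j * z j) * w k, ?_⟩
  rw [srefl_apply, srefl_coef h]
  simp [hz, hw]

lemma IntVec_wprod (h : CD n d A) (l : List (Fin n)) {x : Fin n → ℝ} (hx : IntVec n x) :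
    IntVec n (wprod n d A l x) := by
  induction l generalizing x with
  | nil => simpa [wprod_nil] using hx
  | cons i l ih =>
    rw [wprod_cons, Module.End.mul_apply]
    exact ih (IntVec_srefl h i hx)

lemma wprod_eq_simple (h : CD n d A) (l : List (Fin n)) (s c : Fin n) (y : ℝ) (hy : 0 ≤ y)
    (e : wprod n d A l (sroot n s) = y • sroot n c) : y = 1 := by
  obtain ⟨a, ha⟩ := IntVec_wprod h l (IntVec_sroot s) c
  rw [e] at ha
  have ha : y = a := by simpa [sroot] using ha
  have e2 : sroot n s = y • wprod n d A l.reverse (sroot n c) := by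
    rw [← map_smul, ← e, ← Module.End.mul_apply, wprod_rev_mul h]; simp
  obtain ⟨b, hb⟩ := IntVec_wprod h l.reverse (IntVec_sroot c) s
  have e3 := congrFun e2 s
  simp only [Pi.smul_apply, hb, ha, smul_eq_mul] at e3
  have e4 : (1 : ℤ) = a * b := by
    have : sroot n s s = 1 := by simp [sroot]
    rw [this] at e3
    exact_mod_cast e3
  have ha0 : 0 ≤ a := by rw [ha] at hy; exact_mod_cast hy
  have := Int.eq_one_or_neg_one_of_mul_eq_one e4.symm
  rw [ha]
  rcases this with h1 | h1
  · simp [h1]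
  · omega

lemma conj_eq (h : CD n d A) (l : List (Fin n)) (j : Fin n) :
    wprod n d A l * simpleRefl n d A j * wprod n d A l.reverse
      = reflAlong n d A (wprod n d A l (sroot n j)) := by
  have hj := h.dpos j
  have e0 : 2 / (2 * (d j : ℝ)) = (d j : ℝ)⁻¹ := by field_simp
  refine LinearMap.ext fun x => ?_
  have e1 : wprod n d A l (wprod n d A l.reverse x) = x := by
    rw [← Module.End.mul_apply, wprod_mul_rev h]; rfl
  have e2 : formL n d A (sroot n j) (wprod n d A l.reverse x)
      = formL n d A (wprod n d A l (sroot n j)) x := by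
    rw [← wprod_form h l, e1]
  simp only [Module.End.mul_apply, srefl_apply, map_sub, map_smul, e1, e2]
  simp [reflAlong, wprod_form h, formL_self h, smul_smul, e0]

lemma refl_sroot (h : CD n d A) (c : Fin n) :
    reflAlong n d A (sroot n c) = simpleRefl n d A c := by
  have := conj_eq h [] c
  simpa [wprod_nil] using this.symm

lemma conj_simple (h : CD n d A) (l : List (Fin n)) (s c : Fin n)
    (e : wprod n d A l (sroot n s) = sroot n c) :
    wprod n d A l * simpleRefl n d A s = simpleRefl n d A c * wprod n d A l := by
  have := conj_eq h l s
  rw [e, refl_sroot h] at this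
  rw [← this, mul_assoc, wprod_rev_mul h, mul_one]

lemma det_srefl (h : CD n d A) (i : Fin n) : LinearMap.det (simpleRefl n d A i) = -1 := by
  have e : simpleRefl n d A i = Matrix.toLin' (1 - Matrix.replicateCol Unit (sroot n i) *
      Matrix.replicateRow Unit (fun j => (A i j : ℝ))) := by
    refine LinearMap.ext fun x => ?_
    rw [srefl_apply, srefl_coef h, map_sub, LinearMap.sub_apply, Matrix.toLin'_one,
      Matrix.toLin'_mul, LinearMap.comp_apply, LinearMap.id_apply]
    congr 1
    ext k
    simp [Matrix.toLin'_apply, Matrix.mulVec, dotProduct, mul_comm]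
  rw [e, LinearMap.det_toLin', Matrix.det_one_sub_mul_comm, Matrix.det_unique]
  simp [Matrix.mul_apply, sroot, Pi.single_apply, h.hdiag]
  norm_num

lemma det_wprod (h : CD n d A) (l : List (Fin n)) :
    LinearMap.det (wprod n d A l) = (-1) ^ l.length := by
  induction l with
  | nil => simp [wprod_nil]
  | cons i l ih => rw [wprod_cons, map_mul, ih, det_srefl h, List.length_cons, pow_succ]

lemma parity (h : CD n d A) {l l' : List (Fin n)} (e : wprod n d A l = wprod n d A l') :
    l.length % 2 = l'.length % 2 := by
  have := congrArg LinearMap.det e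
  rw [det_wprod h, det_wprod h] at this
  rcases Nat.even_or_odd l.length with h1 | h1 <;> rcases Nat.even_or_odd l'.length with h2 | h2
  · rw [Nat.even_iff.1 h1, Nat.even_iff.1 h2]
  · rw [h1.neg_one_pow, h2.neg_one_pow] at this; norm_num at this
  · rw [h1.neg_one_pow, h2.neg_one_pow] at this; norm_num at this
  · rw [Nat.odd_iff.1 h1, Nat.odd_iff.1 h2]

/-- reduced words -/
def Red (n : ℕ) (d : Fin n → ℤ) (A : Fin n → Fin n → ℤ) (l : List (Fin n)) : Prop :=
  ∀ l', wprod n d A l' = wprod n d A l → l.length ≤ l'.length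

lemma Red.of_append {p q : List (Fin n)} (hr : Red n d A (p ++ q)) :
    Red n d A p ∧ Red n d A q := by
  constructor
  · intro p' e
    have := hr (p' ++ q) (by rw [wprod_append, wprod_append, e])
    simp at this; omega
  · intro p' e
    have := hr (p ++ p') (by rw [wprod_append, wprod_append, e])
    simp at this; omega

lemma wprod_rev_congr (h : CD n d A) {p q : List (Fin n)} (e : wprod n d A p = wprod n d A q) :
    wprod n d A p.reverse = wprod n d A q.reverse := by
  calc _ = wprod n d A p.reverse * (wprod n d A q * wprod n d A q.reverse) := by
        rw [wprod_mul_rev h, mul_one]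
    _ = _ := by rw [← e, ← mul_assoc, wprod_rev_mul h, one_mul]

lemma Red.rev (h : CD n d A) {p : List (Fin n)} (hr : Red n d A p) : Red n d A p.reverse := by
  intro q e
  have := hr q.reverse (by rw [wprod_rev_congr h e, List.reverse_reverse])
  simpa using this

lemma Red.congr {p q : List (Fin n)} (hr : Red n d A p) (e : wprod n d A q = wprod n d A p)
    (hl : q.length ≤ p.length) : Red n d A q := by
  intro q' e'
  exact hl.trans (hr q' (e'.trans e))

lemma exists_red (l : List (Fin n)) :
    ∃ q, wprod n d A q = wprod n d A l ∧ Red n d A q := by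
  classical
  have hex : ∃ r, ∃ q : List (Fin n), q.length = r ∧ wprod n d A q = wprod n d A l :=
    ⟨_, l, rfl, rfl⟩
  obtain ⟨q, hq, e⟩ := Nat.find_spec hex
  refine ⟨q, e, fun q' e' => ?_⟩
  rw [hq]
  exact Nat.find_min' hex ⟨q', rfl, e'.trans e⟩

/-- if `s :: q` is not reduced, with `q` reduced, we can shorten -/
lemma not_red_cons (h : CD n d A) {s : Fin n} {q : List (Fin n)}
    (hn : ¬ Red n d A (s :: q)) :
    ∃ q', wprod n d A q' = wprod n d A q * simpleRefl n d A s ∧ q'.length + 1 ≤ q.length := by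
  unfold Red at hn
  push Not at hn
  obtain ⟨q', e, hl⟩ := hn
  refine ⟨q', by rw [e, wprod_cons], ?_⟩
  have := parity h e
  simp at this hl
  omega

lemma rank_two_arith (D E a x y : ℤ) (hE : 0 < E) (hD : 0 < D) (ha : 0 ≤ a) 
    (hy : 0 ≤ y) (hneg : a * y - x < 0)
    (F : ℤ) (hF : F = D ∨ F = E) (hQ : D * x ^ 2 - D * a * x * y + E * y ^ 2 = F) : y = 0 := by
  by_contra h0
  have hy1 : 1 ≤ y := by omega
  have hx : 1 ≤ x := by nlinarith [mul_nonneg ha hy]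
  have h1 : D * x ≤ D * x * (x - a * y) := by
    have : 0 < D * x := by positivity
    nlinarith
  have h2 : D ≤ D * x := by nlinarith
  have h3 : E ≤ E * y ^ 2 := le_mul_of_one_le_right hE.le (one_le_pow₀ hy1)
  rcases hF with rfl | rfl <;> nlinarith

lemma rank_two (h : CD n d A) {s t : Fin n} (hst : s ≠ t) (p : List (Fin n))
    (hp : ∀ c ∈ p, c = s ∨ c = t) (hr : Red n d A (s :: p)) :
    ∃ x y : ℤ, 0 ≤ x ∧ 0 ≤ y ∧
      wprod n d A p (sroot n s) = (x : ℝ) • sroot n s + (y : ℝ) • sroot n t := by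
  induction p using List.reverseRecOn with
  | nil => exact ⟨1, 0, by norm_num, le_rfl, by simp [wprod_nil]⟩
  | append_singleton p c ih =>
    obtain ⟨x, y, hx, hy, e⟩ := ih (fun c hc => hp c (by simp [hc]))
      ((Red.of_append (q := [c]) (by simpa using hr)).1)
    have hQ := wprod_form h p (sroot n s) (sroot n s)
    rw [e] at hQ
    simp only [map_add, map_smul, LinearMap.add_apply, LinearMap.smul_apply, formL_sroot,
      smul_eq_mul, h.hdiag] at hQ
    have hQ' : x * (x * (d s * 2) + y * (d t * A t s))
      + y * (x * (d s * A s t) + y * (d t * 2)) = d s * 2 := by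
      have : ((x * (x * (d s * 2) + y * (d t * A t s))
      + y * (x * (d s * A s t) + y * (d t * 2)) : ℤ) : ℝ) = ((d s * 2 : ℤ) : ℝ) := by
        push_cast
        push_cast at hQ
        linarith
      exact_mod_cast this
    have hbad : ∀ z : ℝ, 0 ≤ z → wprod n d A p (sroot n s) = z • sroot n c → False := by
      intro z hz e'
      have hz1 := wprod_eq_simple h p s c z hz e'
      rw [hz1, one_smul] at e'
      have h1 := conj_simple h p s c e'
      have := hr p (by
        rw [← List.cons_append, wprod_snoc, wprod_cons, h1, ← mul_assoc, srefl_invol h, one_mul])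
      simp at this
    have hds := h.dpos s
    have hdt := h.dpos t
    have hs := h.hsym s t
    rw [wprod_snoc, Module.End.mul_apply, e, srefl_apply]
    simp only [map_add, map_smul, formL_sroot, smul_eq_mul]
    rcases hp c (by simp) with rfl | rfl
    · by_cases hneg : (-A c t) * y - x < 0
      · exfalso
        have := rank_two_arith (d c) (d t) (-A c t) x y (h.hd t) (h.hd c)
          (by have := h.hoff c t hst; omega) hy hneg (d c) (Or.inl rfl) (by
            rw [← hs] at hQ'; linarith)
        exact hbad x (by exact_mod_cast hx) (by rw [e, this]; simp)
      · refine ⟨(-A c t) * y - x, y, by omega, hy, ?_⟩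
        rw [h.hdiag]
        have : (d c : ℝ)⁻¹ * (x * (d c * (2 : ℤ)) + y * (d c * A c t))
          = 2 * x + A c t * y := by field_simp; push_cast; ring
        rw [this]; push_cast; module
    · by_cases hneg : (-A c s) * x - y < 0
      · exfalso
        have := rank_two_arith (d c) (d s) (-A c s) y x (h.hd s) (h.hd c)
          (by have := h.hoff c s hst.symm; omega) hx hneg (d s) (Or.inr rfl) (by
            rw [hs] at hQ'; linarith)
        exact hbad y (by exact_mod_cast hy) (by rw [e, this]; simp)
      · refine ⟨x, (-A c s) * x - y, hx, by omega, ?_⟩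
        rw [h.hdiag]
        have : (d c : ℝ)⁻¹ * (x * (d c * A c s) + y * (d c * (2 : ℤ)))
          = 2 * y + A c s * x := by field_simp; push_cast; ring
        rw [this]; push_cast; module

lemma sroot_nonneg (i : Fin n) : 0 ≤ sroot n i := by
  unfold sroot; rw [Pi.single_nonneg]; exact zero_le_one

lemma pos_of_red (h : CD n d A) : ∀ (N : ℕ) (l : List (Fin n)) (s : Fin n), l.length = N →
    Red n d A (s :: l) → 0 ≤ wprod n d A l (sroot n s) := by
  intro N
  induction N using Nat.strong_induction_on with
  | _ N IH =>
  intro l s hl hr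
  cases l with
  | nil => simpa [wprod_nil] using sroot_nonneg s
  | cons t l' =>
  have hst : s ≠ t := by
    rintro rfl
    have := hr l' (by rw [wprod_cons, wprod_cons, mul_assoc, srefl_invol h, mul_one])
    simp at this
  classical
  have hex : ∃ r, ∃ p q : List (Fin n), q.length = r ∧ (∀ c ∈ p, c = s ∨ c = t) ∧
      p.length + q.length = N ∧ wprod n d A (p ++ q) = wprod n d A (t :: l') :=
    ⟨_, [t], l', rfl, by simp, by simp at hl ⊢; omega, rfl⟩
  obtain ⟨p, q, hq, hp, hpq, e⟩ := Nat.find_spec hex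
  have hmin := fun {m} => Nat.find_min' hex (m := m)
  rw [← hq] at hmin
  have hqN : q.length < N := by
    have := hmin ⟨[t], l', rfl, by simp, by simp at hl ⊢; omega, rfl⟩
    simp at hl; omega
  have hr' : Red n d A (s :: (p ++ q)) := by
    refine hr.congr (by rw [wprod_cons, e, ← wprod_cons]) ?_
    simp at hl ⊢; omega
  have hrl : Red n d A (t :: l') := (Red.of_append (p := [s]) hr).2
  have key : ∀ c, (c = s ∨ c = t) → Red n d A (c :: q) := by
    intro c hc
    by_contra hcon
    obtain ⟨q', e', hl'⟩ := not_red_cons h hcon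
    have e2 : wprod n d A ((p ++ [c]) ++ q') = wprod n d A (t :: l') := by
      rw [wprod_append, wprod_snoc, e', mul_assoc, ← mul_assoc (simpleRefl n d A c),
        srefl_invol h, one_mul, ← wprod_append, e]
    have h3 := hrl _ e2
    have := hmin ⟨p ++ [c], q', rfl, by
      intro c' hc'
      rcases List.mem_append.1 hc' with h4 | h4
      · exact hp c' h4
      · rw [List.mem_singleton.1 h4]; exact hc, by
        simp at h3 hl ⊢; omega, e2⟩
    omega
  obtain ⟨x, y, hx, hy, exy⟩ := rank_two h hst p hp (Red.of_append (q := q) (by simpa using hr')).1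
  have h1 := IH _ hqN q s rfl (key s (Or.inl rfl))
  have h2 := IH _ hqN q t rfl (key t (Or.inr rfl))
  rw [← e, wprod_append, Module.End.mul_apply, exy, map_add, map_smul, map_smul]
  have hx' : (0 : ℝ) ≤ x := by exact_mod_cast hx
  have hy' : (0 : ℝ) ≤ y := by exact_mod_cast hy
  exact add_nonneg (smul_nonneg hx' h1) (smul_nonneg hy' h2)

lemma neg_of_not_red (h : CD n d A) {l : List (Fin n)} {s : Fin n} (hl : Red n d A l)
    (hr : ¬ Red n d A (s :: l)) : wprod n d A l (sroot n s) ≤ 0 := by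
  obtain ⟨q, e, hq⟩ := not_red_cons h hr
  have e2 : wprod n d A (s :: q) = wprod n d A l := by
    rw [wprod_cons, e, mul_assoc, srefl_invol h, mul_one]
  have h1 := pos_of_red h _ q s rfl (hl.congr e2 (by simpa using hq))
  rw [e, Module.End.mul_apply, srefl_self h, map_neg] at h1
  exact neg_nonneg.1 h1

lemma pos_or_neg (h : CD n d A) (l : List (Fin n)) (s : Fin n) :
    0 ≤ wprod n d A l (sroot n s) ∨ wprod n d A l (sroot n s) ≤ 0 := by
  obtain ⟨q, e, hq⟩ := exists_red (d := d) (A := A) l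
  rw [← e]
  by_cases hr : Red n d A (s :: q)
  · exact Or.inl (pos_of_red h _ q s rfl hr)
  · exact Or.inr (neg_of_not_red h hq hr)

lemma sroot_ne (i : Fin n) : sroot n i ≠ 0 := by simp [sroot]

lemma red_cons_iff (h : CD n d A) {l : List (Fin n)} {s : Fin n} (hl : Red n d A l) :
    Red n d A (s :: l) ↔ 0 ≤ wprod n d A l (sroot n s) := by
  refine ⟨pos_of_red h _ l s rfl, fun h0 => ?_⟩
  by_contra hr
  exact sroot_ne s (wprod_inj h l (le_antisymm (neg_of_not_red h hl hr) h0))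

lemma red_snoc_iff (h : CD n d A) {l : List (Fin n)} {s : Fin n} (hl : Red n d A l) :
    Red n d A (l ++ [s]) ↔ 0 ≤ wprod n d A l.reverse (sroot n s) := by
  rw [← red_cons_iff h (hl.rev h)]
  constructor
  · intro hr; simpa using hr.rev h
  · intro hr; simpa using hr.rev h

lemma len_eq_iff (l : List (Fin n)) (w : Module.End ℝ (Fin n → ℝ)) (e : wprod n d A l = w) :
    len n d A w = l.length ↔ Red n d A l := by
  have hne : {r | ∃ l : List (Fin n), l.length = r ∧ wprod n d A l = w}.Nonempty := ⟨_, l, rfl, e⟩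
  constructor
  · intro hl l' e'
    rw [← hl]
    exact Nat.sInf_le ⟨l', rfl, e'.trans e⟩
  · intro hr
    apply le_antisymm
    · exact Nat.sInf_le ⟨l, rfl, e⟩
    · obtain ⟨l', h1, h2⟩ := Nat.sInf_mem hne
      unfold len
      rw [← h1]
      exact hr l' (h2.trans e.symm)

/-- the palindromic word -/
def pal (j : Fin n) (l : List (Fin n)) : List (Fin n) := l.reverse ++ j :: l

lemma pal_snoc (j i : Fin n) (l : List (Fin n)) : pal j (l ++ [i]) = i :: (pal j l ++ [i]) := by
  simp [pal]

lemma pal_rev (j : Fin n) (l : List (Fin n)) : (pal j l).reverse = pal j l := by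
  simp [pal]

lemma wprod_pal (j : Fin n) (l : List (Fin n)) : wprod n d A (pal j l) =
    wprod n d A l * simpleRefl n d A j * wprod n d A l.reverse := by
  rw [pal, wprod_append, wprod_cons]

lemma IsPosExpr_snoc (h : CD n d A) (j i : Fin n) (l : List (Fin n)) :
    IsPosExpr n d A j (l ++ [i]) ↔ IsPosExpr n d A j l ∧
      formL n d A (sroot n i) (wprod n d A l (sroot n j)) < 0 := by
  have hdi := h.dpos i
  constructor
  · intro hp
    constructor
    · intro k
      have hk := k.2
      obtain ⟨c, hc, e⟩ := hp ⟨k.1, by simp⟩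
      refine ⟨c, hc, ?_⟩
      simp only [List.get_eq_getElem] at e ⊢
      rw [List.take_append_of_le_length (by omega), List.take_append_of_le_length (by omega),
        List.getElem_append_left hk] at e
      exact e
    · obtain ⟨c, hc, e⟩ := hp ⟨l.length, by simp⟩
      simp only [List.get_eq_getElem] at e
      rw [List.take_of_length_le (by simp), List.take_left, List.getElem_concat_length rfl,
        wprod_snoc, Module.End.mul_apply, srefl_apply] at e
      have e2 := congrFun e i
      simp [sroot] at e2
      have : formL n d A (sroot n i) (wprod n d A l (sroot n j)) = - (d i * c) := by
        rw [← e2]; simp only [sroot]; field_simp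
      rw [this]
      have := mul_pos hdi hc
      linarith
  · rintro ⟨hp, hneg⟩ k
    by_cases hk : k.1 < l.length
    · obtain ⟨c, hc, e⟩ := hp ⟨k.1, hk⟩
      refine ⟨c, hc, ?_⟩
      simp only [List.get_eq_getElem] at e ⊢
      rw [List.take_append_of_le_length (by omega), List.take_append_of_le_length (by omega),
        List.getElem_append_left hk]
      exact e
    · obtain ⟨k, hk'⟩ := k
      have : k = l.length := by simp at hk hk'; omega
      subst this
      refine ⟨-((d i : ℝ)⁻¹ * formL n d A (sroot n i) (wprod n d A l (sroot n j))), ?_, ?_⟩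
      · have := mul_pos (inv_pos.2 hdi) (neg_pos.2 hneg)
        linarith
      · simp only [List.get_eq_getElem]
        rw [List.take_of_length_le (by simp), List.take_left, List.getElem_concat_length rfl,
          wprod_snoc, Module.End.mul_apply, srefl_apply]
        module

lemma pos_of_posExpr (h : CD n d A) (j : Fin n) (l : List (Fin n)) (hp : IsPosExpr n d A j l) :
    0 ≤ wprod n d A l (sroot n j) := by
  induction l using List.reverseRecOn with
  | nil => simpa [wprod_nil] using sroot_nonneg j
  | append_singleton l i ih =>
    rw [IsPosExpr_snoc h] at hp
    have h1 := ih hp.1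
    rw [wprod_snoc, Module.End.mul_apply, srefl_apply]
    have := mul_pos (inv_pos.2 (h.dpos i)) (neg_pos.2 hp.2)
    rw [sub_eq_add_neg, ← neg_smul]
    exact add_nonneg h1 (smul_nonneg (by linarith) (sroot_nonneg i))

lemma pal_apply (h : CD n d A) (j : Fin n) (l : List (Fin n)) (x : Fin n → ℝ) :
    wprod n d A (pal j l) x = x - ((d j : ℝ)⁻¹ * formL n d A (wprod n d A l (sroot n j)) x) •
      wprod n d A l (sroot n j) := by
  have hj := h.dpos j
  have e0 : 2 / (2 * (d j : ℝ)) = (d j : ℝ)⁻¹ := by field_simp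
  rw [wprod_pal, conj_eq h]
  simp [reflAlong, wprod_form h, formL_self h, smul_smul, e0]

lemma support_simple (γ : Fin n → ℝ) (i : Fin n) (hγ : ∀ k, k ≠ i → γ k = 0) :
    γ = γ i • sroot n i := by
  ext k
  by_cases hk : k = i
  · subst hk; simp [sroot]
  · simp [sroot, hk, hγ k hk]

lemma posExpr_iff (h : CD n d A) (j : Fin n) (l : List (Fin n)) :
    IsPosExpr n d A j l ↔ Red n d A (pal j l) := by
  induction l using List.reverseRecOn with
  | nil =>
    refine ⟨fun _ => ?_, fun _ k => k.elim0⟩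
    have h0 : Red n d A ([] : List (Fin n)) := fun _ _ => by simp
    have := (red_cons_iff h (s := j) h0).2 (by simpa [wprod_nil] using sroot_nonneg j)
    simpa [pal] using this
  | append_singleton l i ih =>
    have hdi := h.dpos i
    have hdj := h.dpos j
    rw [IsPosExpr_snoc h, pal_snoc]
    set γ := wprod n d A l (sroot n j) with hγ
    constructor
    · rintro ⟨hp, hneg⟩
      have hγ0 : 0 ≤ γ := pos_of_posExpr h j l hp
      have hT := ih.1 hp
      have hc : 0 < -((d j : ℝ)⁻¹ * formL n d A γ (sroot n i)) := by
        rw [formL_symm h]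
        have := mul_pos (inv_pos.2 hdj) (neg_pos.2 hneg)
        linarith
      have e1 : wprod n d A (pal j l) (sroot n i)
          = sroot n i + (-((d j : ℝ)⁻¹ * formL n d A γ (sroot n i))) • γ := by
        rw [pal_apply h]; module
      have hTi : Red n d A (pal j l ++ [i]) := by
        rw [red_snoc_iff h hT, pal_rev, e1]
        exact add_nonneg (sroot_nonneg i) (smul_nonneg hc.le hγ0)
      rw [red_cons_iff h hTi]
      rcases pos_or_neg h (pal j l ++ [i]) i with h1 | h1
      · exact h1
      exfalso
      rw [wprod_snoc, Module.End.mul_apply, srefl_apply, e1] at h1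
      have hs : ∀ k, k ≠ i → γ k = 0 := by
        intro k hk
        have h2 := h1 k
        have h3 : (-((d j : ℝ)⁻¹ * formL n d A γ (sroot n i))) * γ k ≤ 0 := by
          simpa [sroot, hk] using h2
        have h4 : 0 ≤ γ k := hγ0 k
        nlinarith
      have e3 := support_simple γ i hs
      rw [e3, map_smul, formL_self h, smul_eq_mul] at hneg
      have h4 : 0 ≤ γ i := hγ0 i
      have := mul_nonneg h4 (by linarith : 0 ≤ 2 * (d i : ℝ))
      linarith
    · intro hr
      have hTi : Red n d A (pal j l ++ [i]) := (Red.of_append (p := [i]) hr).2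
      have hT : Red n d A (pal j l) := (Red.of_append hTi).1
      have hp := ih.2 hT
      refine ⟨hp, ?_⟩
      have hγ0 : 0 ≤ γ := pos_of_posExpr h j l hp
      have h1 := (red_snoc_iff h hT).1 hTi
      rw [pal_rev] at h1
      have h2 := (red_cons_iff h hTi).1 hr
      rw [wprod_snoc, Module.End.mul_apply] at h2
      rw [pal_apply h] at h1 h2
      rw [← hγ, formL_symm h γ] at h1 h2
      by_contra hcon
      push Not at hcon
      rcases hcon.eq_or_lt with h0 | h0
      · rw [← h0] at h2
        simp only [mul_zero, zero_smul, sub_zero, srefl_self h] at h2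
        exact sroot_ne i (le_antisymm (neg_nonneg.1 h2) (sroot_nonneg i))
      · have hc : 0 < (d j : ℝ)⁻¹ * formL n d A (sroot n i) γ := mul_pos (inv_pos.2 hdj) h0
        have hs : ∀ k, k ≠ i → γ k = 0 := by
          intro k hk
          have h2 := h1 k
          have h3 : ((d j : ℝ)⁻¹ * formL n d A (sroot n i) γ) * γ k ≤ 0 := by
            simpa [sroot, hk] using h2
          have h4 : 0 ≤ γ k := hγ0 k
          nlinarith
        have e3 := support_simple γ i hs
        have h5 : γ i = 1 := wprod_eq_simple h l j i (γ i) (hγ0 i) e3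
        rw [h5, one_smul] at e3
        have h6 := wprod_form h l (sroot n j) (sroot n j)
        rw [← hγ, e3, formL_self h, formL_self h] at h6
        have h7 : (d i : ℝ) = d j := by linarith
        have h8 := h1 i
        rw [e3, formL_self h, h7] at h8
        have h9 : (d j : ℝ)⁻¹ * (2 * d j) = 2 := by field_simp
        rw [h9] at h8
        simp [sroot] at h8

end aux

/-- for `γ = s i_r ⋯ s i_1 (α j)` and
`t = s i_r ⋯ s i_1 * s j * s i_1 ⋯ s i_r`, the expression is positive iff
`ℓ(t) = 2r + 1`; and in that case `γ` is a positive root and `t = t_γ`. -/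
theorem stmt2 (n : ℕ) (hn : 1 ≤ n) (d : Fin n → ℤ) (A : Fin n → Fin n → ℤ)
    (hd : ∀ i, 0 < d i) (hdiag : ∀ i, A i i = 2)
    (hoff : ∀ i j, i ≠ j → A i j ≤ 0)
    (hsym : ∀ i j, d i * A i j = d j * A j i)
    (j : Fin n) (l : List (Fin n)) :
    (IsPosExpr n d A j l ↔
        len n d A (wprod n d A l * simpleRefl n d A j * wprod n d A l.reverse)
          = 2 * l.length + 1)
    ∧ (IsPosExpr n d A j l →
        IsPosRoot n d A (wprod n d A l (sroot n j)) ∧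
          wprod n d A l * simpleRefl n d A j * wprod n d A l.reverse
            = reflAlong n d A (wprod n d A l (sroot n j))) := by
  have h : CD n d A := ⟨hd, hdiag, hoff, hsym⟩
  have hl : (pal j l).length = 2 * l.length + 1 := by simp [pal]; omega
  refine ⟨?_, fun hp => ⟨⟨⟨l, j, rfl⟩, pos_of_posExpr h j l hp⟩, conj_eq h l j⟩⟩
  rw [posExpr_iff h, ← hl, len_eq_iff _ _ (wprod_pal j l)]

end
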